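/- Under the gradient descent setup (f nonnegative C², 4 f(x₀) < r² α with α = α(x₀,r); ε ∈ (0,1) with 4 f(x₀) < (1−ε)² r² α; L₁, L₂ bounds on first derivatives on B(x₀,r) and second derivatives on B(x₀,2r) respectively; step size η ≤ min{ r/(L₁√p), 2ε/(L₂ p) }; and x_{k+1} := x_k − η∇f(x_k)), the iterates satisfy x_k ∈ B(x₀,r) for all k ≥ 0. -/

import Mathlib

open Set Filter Metric

/-- A linear functional on `EuclideanSpace` expands along the standard basis. -/
theorem clm_apply_eq_sum_coord {p : ℕ} (l : EuclideanSpace ℝ (Fin p) →L[ℝ] ℝ)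
    (v : EuclideanSpace ℝ (Fin p)) :
    l v = ∑ i, v i * l (EuclideanSpace.single i 1) := by
  conv_lhs => rw [← (EuclideanSpace.basisFun (Fin p) ℝ).sum_repr v]
  simp [map_sum]

theorem sq_sum_abs_coord_le {p : ℕ} (v : EuclideanSpace ℝ (Fin p)) :
    (∑ i, |v i|) ^ 2 ≤ p * ‖v‖ ^ 2 := by
  have h := sq_sum_le_card_mul_sum_sq (s := Finset.univ) (f := fun i => |v i|)
  simpa [EuclideanSpace.norm_sq_eq] using h

theorem gradient_coord {p : ℕ} (f : EuclideanSpace ℝ (Fin p) → ℝ)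
    (z : EuclideanSpace ℝ (Fin p)) (i : Fin p) :
    gradient f z i = fderiv ℝ f z (EuclideanSpace.single i 1) := by
  have h : inner ℝ (gradient f z) (EuclideanSpace.single i (1 : ℝ))
      = fderiv ℝ f z (EuclideanSpace.single i 1) := by
    simp [gradient, InnerProductSpace.toDual_symm_apply]
  rw [← h, EuclideanSpace.inner_single_right]
  simp

theorem norm_gradient_le {p : ℕ} {f : EuclideanSpace ℝ (Fin p) → ℝ}
    {z : EuclideanSpace ℝ (Fin p)} {L : ℝ} (hL : 0 ≤ L)
    (h : ∀ i, |fderiv ℝ f z (EuclideanSpace.single i 1)| ≤ L) :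
    ‖gradient f z‖ ≤ L * Real.sqrt p := by
  refine le_of_sq_le_sq ?_ (by positivity)
  rw [EuclideanSpace.norm_sq_eq, mul_pow, Real.sq_sqrt (by positivity)]
  calc ∑ i, ‖gradient f z i‖ ^ 2 ≤ ∑ _i : Fin p, L ^ 2 := by
        refine Finset.sum_le_sum fun i _ => ?_
        rw [gradient_coord, Real.norm_eq_abs]
        exact pow_le_pow_left₀ (abs_nonneg _) (h i) 2
    _ = L ^ 2 * p := by simp [mul_comm]

/-- First-order Taylor upper bound for a function on `[0, 1]` with bounded second derivative. -/
theorem le_taylor_of_deriv2_le {φ φ' φ'' : ℝ → ℝ} {C : ℝ}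
    (h1 : ∀ t, HasDerivAt φ (φ' t) t) (h2 : ∀ t, HasDerivAt φ' (φ'' t) t)
    (hC : ∀ t ∈ Icc (0 : ℝ) 1, φ'' t ≤ C) :
    φ 1 ≤ φ 0 + φ' 0 + C / 2 := by
  have hd : ∀ t, HasDerivAt (fun t => C * t - φ' t) (C - φ'' t) t := fun t => by
    simpa using ((hasDerivAt_id t).const_mul C).fun_sub (h2 t)
  have hmono : MonotoneOn (fun t => C * t - φ' t) (Icc 0 1) := by
    refine monotoneOn_of_deriv_nonneg (convex_Icc 0 1)
      (fun t _ => (hd t).continuousAt.continuousWithinAt)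
      (fun t _ => (hd t).differentiableAt.differentiableWithinAt) fun t ht => ?_
    rw [(hd t).deriv]
    linarith [hC t (interior_subset ht)]
  have hd' : ∀ t, HasDerivAt (fun t => φ' 0 * t + C / 2 * t ^ 2 - φ t)
      (φ' 0 + C * t - φ' t) t := fun t => by
    have := (((hasDerivAt_id t).const_mul (φ' 0)).add
      ((hasDerivAt_pow 2 t).const_mul (C / 2))).sub (h1 t)
    refine this.congr_deriv ?_
    norm_num
    ring
  have hmono' : MonotoneOn (fun t => φ' 0 * t + C / 2 * t ^ 2 - φ t) (Icc 0 1) := by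
    refine monotoneOn_of_deriv_nonneg (convex_Icc 0 1)
      (fun t _ => (hd' t).continuousAt.continuousWithinAt)
      (fun t _ => (hd' t).differentiableAt.differentiableWithinAt) fun t ht => ?_
    rw [(hd' t).deriv]
    have ht' := interior_subset ht
    have := hmono (by simp) ht' ht'.1
    simp only [mul_zero] at this
    linarith
  have := hmono' (by simp : (0 : ℝ) ∈ Icc 0 1) (by simp : (1 : ℝ) ∈ Icc 0 1) zero_le_one
  norm_num at this
  linarith

/-- First-order Taylor upper bound along a segment on which the second-order partial derivatives
are bounded. -/
theorem le_taylor_of_partial_deriv2_le {p : ℕ} {f : EuclideanSpace ℝ (Fin p) → ℝ}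
    (hf : ContDiff ℝ 2 f) {x v : EuclideanSpace ℝ (Fin p)} {L : ℝ} (hL0 : 0 ≤ L)
    (hL : ∀ t ∈ Icc (0 : ℝ) 1, ∀ i j : Fin p,
      |fderiv ℝ (fun v => fderiv ℝ f v (EuclideanSpace.single i 1)) (x + t • v)
        (EuclideanSpace.single j 1)| ≤ L) :
    f (x + v) ≤ f x + fderiv ℝ f x v + L * p * ‖v‖ ^ 2 / 2 := by
  have hline : ∀ t : ℝ, HasDerivAt (fun t : ℝ => x + t • v) v t := fun t => by
    simpa using ((hasDerivAt_id t).smul_const v).const_add x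
  have hdiff : ∀ i : Fin p,
      Differentiable ℝ fun v => fderiv ℝ f v (EuclideanSpace.single i 1) := fun i =>
    ((hf.fderiv_right (m := 1) (by norm_num)).clm_apply contDiff_const).differentiable (by norm_num)
  have h1 : ∀ t : ℝ, HasDerivAt (fun t : ℝ => f (x + t • v))
      (∑ i, v i * fderiv ℝ f (x + t • v) (EuclideanSpace.single i 1)) t := fun t => by
    rw [← clm_apply_eq_sum_coord]
    exact ((hf.differentiable (by norm_num)) (x + t • v)).hasFDerivAt.comp_hasDerivAt t (hline t)
  have h2 : ∀ t : ℝ, HasDerivAt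
      (fun t : ℝ => ∑ i, v i * fderiv ℝ f (x + t • v) (EuclideanSpace.single i 1))
      (∑ i, v i * ∑ j, v j *
        fderiv ℝ (fun v => fderiv ℝ f v (EuclideanSpace.single i 1)) (x + t • v)
          (EuclideanSpace.single j 1)) t := fun t => by
    refine HasDerivAt.fun_sum fun i _ => HasDerivAt.const_mul _ ?_
    rw [← clm_apply_eq_sum_coord]
    exact (hdiff i (x + t • v)).hasFDerivAt.comp_hasDerivAt t (hline t)
  have := le_taylor_of_deriv2_le (C := L * p * ‖v‖ ^ 2) h1 h2 fun t ht => by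
    calc _ ≤ ∑ i, |v i| * ∑ j, |v j| * L := by
          refine Finset.sum_le_sum fun i _ => ?_
          refine (le_abs_self _).trans ?_
          rw [abs_mul]
          refine mul_le_mul_of_nonneg_left ?_ (abs_nonneg _)
          refine (Finset.abs_sum_le_sum_abs _ _).trans (Finset.sum_le_sum fun j _ => ?_)
          rw [abs_mul]
          exact mul_le_mul_of_nonneg_left (hL t ht i j) (abs_nonneg _)
      _ = L * (∑ i, |v i|) ^ 2 := by
          rw [← Finset.sum_mul, ← Finset.sum_mul]
          ring
      _ ≤ L * (p * ‖v‖ ^ 2) := mul_le_mul_of_nonneg_left (sq_sum_abs_coord_le v) hL0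
      _ = _ := by ring
  simpa [clm_apply_eq_sum_coord (fderiv ℝ f x) v] using this

/-- **Lemma 4.1.** Under the gradient descent setup (`f` nonnegative `C²`; `4 f(x₀) < r² α` with
`α = α(x₀,r)` formalized via its defining lower-bound property; `ε ∈ (0,1)` with
`4 f(x₀) < (1−ε)² r² α`; `L₁`, `L₂` bounds on the first-order partial derivatives on `B(x₀,r)`
and second-order partial derivatives on `B(x₀,2r)`; step size
`η ≤ min (r/(L₁√p)) (2ε/(L₂ p))`; iterates `x_{k+1} = x_k − η ∇f(x_k)`), the iterates satisfy
`x_k ∈ B(x₀,r)` for all `k ≥ 0`. -/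
theorem gd_iterates_stay_in_ball
    {p : ℕ} (hp : 0 < p)
    (f : EuclideanSpace ℝ (Fin p) → ℝ)
    (hf : ContDiff ℝ 2 f) (hf0 : ∀ x, 0 ≤ f x)
    (x₀ : EuclideanSpace ℝ (Fin p)) (r : ℝ) (hr : 0 < r)
    (α : ℝ)
    (hα : ∀ x ∈ Metric.closedBall x₀ r, f x ≠ 0 → α * f x ≤ ‖gradient f x‖ ^ 2)
    (hmain : 4 * f x₀ < r ^ 2 * α)
    (ε : ℝ) (hε : ε ∈ Set.Ioo (0:ℝ) 1)
    (hmainε : 4 * f x₀ < (1 - ε) ^ 2 * r ^ 2 * α)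
    (L₁ L₂ : ℝ)
    (hL₁ : ∀ z ∈ Metric.closedBall x₀ r, ∀ i : Fin p,
      |fderiv ℝ f z (EuclideanSpace.single i 1)| ≤ L₁)
    (hL₂ : ∀ z ∈ Metric.closedBall x₀ (2 * r), ∀ i j : Fin p,
      |fderiv ℝ (fun v => fderiv ℝ f v (EuclideanSpace.single i 1)) z
        (EuclideanSpace.single j 1)| ≤ L₂)
    (η : ℝ) (hη : 0 < η)
    (hηle : η ≤ min (r / (L₁ * Real.sqrt p)) (2 * ε / (L₂ * p)))
    (x : ℕ → EuclideanSpace ℝ (Fin p)) (hx0 : x 0 = x₀)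
    (hxrec : ∀ k : ℕ, x (k + 1) = x k - η • gradient f (x k)) :
    ∀ k : ℕ, x k ∈ Metric.closedBall x₀ r := by
  obtain ⟨hε0, hε1⟩ := hε
  have hp' : (0 : ℝ) < p := by exact_mod_cast hp
  have hsp : 0 < Real.sqrt p := Real.sqrt_pos.2 hp'
  have hη1 : 0 < r / (L₁ * Real.sqrt p) := hη.trans_le (hηle.trans (min_le_left _ _))
  have hη2 : 0 < 2 * ε / (L₂ * p) := hη.trans_le (hηle.trans (min_le_right _ _))
  have hL₁sp : 0 < L₁ * Real.sqrt p := (div_pos_iff_of_pos_left hr).1 hη1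
  have hL₂p : 0 < L₂ * p := (div_pos_iff_of_pos_left (by positivity)).1 hη2
  have hL₁0 : 0 < L₁ := pos_of_mul_pos_left hL₁sp hsp.le
  have hL₂0 : 0 < L₂ := pos_of_mul_pos_left hL₂p hp'.le
  have hηL₁ : η * (L₁ * Real.sqrt p) ≤ r := (le_div_iff₀ hL₁sp).1 (hηle.trans (min_le_left _ _))
  have hηL₂ : η * (L₂ * p) ≤ 2 * ε := (le_div_iff₀ hL₂p).1 (hηle.trans (min_le_right _ _))
  have hδ : 0 < 1 - ε := by linarith
  have hα0 : 0 < α := by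
    have : 0 < (1 - ε) ^ 2 * r ^ 2 * α := lt_of_le_of_lt (by linarith [hf0 x₀]) hmainε
    exact pos_of_mul_pos_right this (by positivity)
  set s := Real.sqrt α with hs
  have hs0 : 0 < s := Real.sqrt_pos.2 hα0
  have hs2 : s ^ 2 = α := Real.sq_sqrt hα0.le
  have hstart : 2 * Real.sqrt (f x₀) ≤ r * ((1 - ε) * s) := by
    refine le_of_sq_le_sq ?_ (by positivity)
    rw [mul_pow, Real.sq_sqrt (hf0 _), mul_pow, mul_pow, hs2]
    linarith
  have hball : ∀ z, ‖z - x₀‖ * ((1 - ε) * s) + 2 * Real.sqrt (f z) ≤ 2 * Real.sqrt (f x₀) →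
      z ∈ Metric.closedBall x₀ r := fun z hz => by
    rw [mem_closedBall_iff_norm]
    refine le_of_mul_le_mul_right ?_ (by positivity : 0 < (1 - ε) * s)
    linarith [Real.sqrt_nonneg (f z)]
  suffices h : ∀ k, ‖x k - x₀‖ * ((1 - ε) * s) + 2 * Real.sqrt (f (x k)) ≤ 2 * Real.sqrt (f x₀) from
    fun k => hball _ (h k)
  intro k
  induction k with
  | zero => simp [hx0]
  | succ k ih =>
    have hk := hball _ ih
    have hkn := mem_closedBall_iff_norm.1 hk
    rw [hxrec k]
    generalize x k = z at *
    by_cases hz : f z = 0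
    · have hmin : IsLocalMin f z := Eventually.of_forall fun y => hz ▸ hf0 y
      have hg : gradient f z = 0 := by simp [gradient, hmin.fderiv_eq_zero]
      simpa [hg] using ih
    · have hfz : 0 < f z := lt_of_le_of_ne (hf0 z) (Ne.symm hz)
      set g := gradient f z with hgdef
      have hgn : η * ‖g‖ ≤ r :=
        (mul_le_mul_of_nonneg_left (norm_gradient_le hL₁0.le (hL₁ z hk)) hη.le).trans hηL₁
      have hderiv : fderiv ℝ f z (-(η • g)) = -(η * ‖g‖ ^ 2) := by
        have : inner ℝ g g = fderiv ℝ f z g := by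
          rw [hgdef]
          nth_rw 1 [gradient]
          rw [InnerProductSpace.toDual_symm_apply]
        rw [map_neg, map_smul, ← this, real_inner_self_eq_norm_sq, smul_eq_mul]
      have hnv : ‖-(η • g)‖ = η * ‖g‖ := by
        rw [norm_neg, norm_smul, Real.norm_of_nonneg hη.le]
      have hT := le_taylor_of_partial_deriv2_le hf (x := z) (v := -(η • g)) hL₂0.le
        fun t ht => hL₂ _ (by
          rw [mem_closedBall_iff_norm]
          calc ‖z + t • -(η • g) - x₀‖ = ‖(z - x₀) + t • -(η • g)‖ := by congr 1; abel
            _ ≤ ‖z - x₀‖ + ‖t • -(η • g)‖ := norm_add_le _ _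
            _ ≤ r + 1 * r := by
              rw [norm_smul, hnv, Real.norm_of_nonneg ht.1]
              gcongr
              exact ht.2
            _ = 2 * r := by ring)
      rw [hderiv, hnv, ← sub_eq_add_neg] at hT
      have hdesc : f (z - η • g) ≤ f z - (1 - ε) * (η * ‖g‖ ^ 2) := by
        have : η * (L₂ * p) * (η * ‖g‖ ^ 2) ≤ 2 * ε * (η * ‖g‖ ^ 2) :=
          mul_le_mul_of_nonneg_right hηL₂ (by positivity)
        nlinarith
      have ha : 0 < Real.sqrt (f z) := Real.sqrt_pos.2 hfz
      have hga : s * Real.sqrt (f z) ≤ ‖g‖ := by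
        refine le_of_sq_le_sq ?_ (norm_nonneg _)
        rw [mul_pow, hs2, Real.sq_sqrt hfz.le]
        exact hα z hk hz
      have hstep : η * ‖g‖ * ((1 - ε) * s) + 2 * Real.sqrt (f (z - η • g))
          ≤ 2 * Real.sqrt (f z) := by
        have ha2 := Real.sq_sqrt hfz.le
        have hb2 := Real.sq_sqrt (hf0 (z - η • g))
        set a := Real.sqrt (f z)
        set b := Real.sqrt (f (z - η • g))
        have hprod : (1 - ε) * η * ‖g‖ * (s * a) ≤ (1 - ε) * η * ‖g‖ * ‖g‖ :=
          mul_le_mul_of_nonneg_left hga (by positivity)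
        refine le_of_mul_le_mul_right ?_ ha
        nlinarith [sq_nonneg (a - b)]
      have htri : ‖z - η • g - x₀‖ ≤ ‖z - x₀‖ + η * ‖g‖ := by
        calc ‖z - η • g - x₀‖ = ‖(z - x₀) + -(η • g)‖ := by congr 1; abel
          _ ≤ _ := (norm_add_le _ _).trans_eq (by rw [hnv])
      have := mul_le_mul_of_nonneg_right htri (by positivity : 0 ≤ (1 - ε) * s)
      linarith
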